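/- For ω > 0 and z > 0, Barnes' double zeta function satisfies ζ₂(0, ω, xω + y) = (ω/2)B₂(x) + B₁(x)B₁(y) + (1/(2ω))B₂(y), where z = xω + y with x > 0 and y ≥ 0. -/

import Mathlib

/-- `H` is the meromorphic continuation of Barnes' double zeta function
`ζ₂(s,ω,z) = ∑_{p,q≥0} (z + pω + q)^{-s}`. -/
def IsBarnesZeta2 (ω z : ℝ) (H : ℂ → ℂ) : Prop :=
  DifferentiableOn ℂ H ({1, 2} : Set ℂ)ᶜ ∧
    ∀ s : ℂ, 2 < s.re → H s = ∑' (p : ℕ) (q : ℕ), ((z : ℂ) + p * ω + q) ^ (-s)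

open Real Set Filter Topology Asymptotics

def bJet (f : ℝ → ℝ) (a b c : ℝ) : Prop :=
  (fun t => f t - (a + b * t + c * t ^ 2)) =O[𝓝[>] 0] (fun t : ℝ => t ^ 3)

lemma cont_bigO_one {f : ℝ → ℝ} (hf : Continuous f) :
    f =O[𝓝[>] 0] (fun _ : ℝ => (1 : ℝ)) :=
  ((hf.tendsto 0).mono_left nhdsWithin_le_nhds).isBigO_one ℝ

lemma bJet.one {f : ℝ → ℝ} {a b c : ℝ} (h : bJet f a b c) :
    f =O[𝓝[>] 0] (fun _ : ℝ => (1 : ℝ)) := by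
  have h1 : (fun t => f t - (a + b * t + c * t ^ 2)) =O[𝓝[>] 0] (fun _ : ℝ => (1 : ℝ)) :=
    h.trans (cont_bigO_one (by fun_prop))
  have h2 := h1.add (cont_bigO_one (f := fun t => a + b * t + c * t ^ 2) (by fun_prop))
  simpa using h2

lemma bJet.mul {f g : ℝ → ℝ} {a b c a' b' c' : ℝ} (h : bJet f a b c) (h' : bJet g a' b' c') :
    bJet (fun t => f t * g t) (a * a') (a * b' + b * a') (a * c' + b * b' + c * a') := by
  have h1 := IsBigO.mul h h'.one
  have h2 := (cont_bigO_one (f := fun t => a + b * t + c * t ^ 2) (by fun_prop)).mul h'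
  have h3 := (cont_bigO_one (f := fun t => (b * c' + c * b') + c * c' * t) (by fun_prop)).mul
    (isBigO_refl (fun t : ℝ => t ^ 3) (𝓝[>] 0))
  simp only [mul_one, one_mul] at h1 h2 h3
  refine ((h1.add h2).add h3).congr_left fun t => ?_
  ring

lemma bJet.scale {f : ℝ → ℝ} {a b c : ℝ} (h : bJet f a b c) {w : ℝ} (hw : 0 < w) :
    bJet (fun t => f (w * t)) a (b * w) (c * w ^ 2) := by
  have ht : Tendsto (fun t : ℝ => w * t) (𝓝[>] 0) (𝓝[>] 0) := by
    refine tendsto_nhdsWithin_iff.2 ⟨?_, ?_⟩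
    · have : Tendsto (fun t : ℝ => w * t) (𝓝 0) (𝓝 (w * 0)) := by
        exact (continuous_const.mul continuous_id).tendsto 0
      rw [mul_zero] at this
      exact this.mono_left nhdsWithin_le_nhds
    · filter_upwards [self_mem_nhdsWithin] with t ht
      exact mul_pos hw ht
  have h1 := IsBigO.comp_tendsto h ht
  have h2 : ((fun t : ℝ => t ^ 3) ∘ fun t : ℝ => w * t) =O[𝓝[>] 0] (fun t : ℝ => t ^ 3) := by
    refine ((isBigO_refl (fun t : ℝ => t ^ 3) (𝓝[>] 0)).const_mul_left (w ^ 3)).congr_left ?_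
    intro t; simp only [Function.comp]; ring
  refine (h1.trans h2).congr_left fun t => ?_
  simp only [Function.comp]; ring

lemma exp_bigO (z : ℝ) (n : ℕ) :
    (fun t : ℝ => exp (z * t) - ∑ i ∈ Finset.range n, (z * t) ^ i / (Nat.factorial i : ℝ))
      =O[𝓝[>] 0] (fun t : ℝ => t ^ n) := by
  have ht : Tendsto (fun t : ℝ => z * t) (𝓝[>] 0) (𝓝 0) := by
    have : Tendsto (fun t : ℝ => z * t) (𝓝 0) (𝓝 (z * 0)) := by
      exact (continuous_const.mul continuous_id).tendsto 0
    rw [mul_zero] at this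
    exact this.mono_left nhdsWithin_le_nhds
  have h1 := (Real.exp_sub_sum_range_isBigO_pow n).comp_tendsto ht
  refine h1.trans (((isBigO_refl (fun t : ℝ => t ^ n) (𝓝[>] 0)).const_mul_left (z ^ n)).congr_left ?_)
  intro t; simp only [Function.comp]; ring

lemma bJet_exp (z : ℝ) : bJet (fun t => exp (z * t)) 1 z (z ^ 2 / 2) := by
  refine (exp_bigO z 3).congr_left fun t => ?_
  simp [Finset.sum_range_succ]; ring

lemma bJet_psi : bJet (fun t => (1 - exp (-t)) / t) 1 (-1 / 2) (1 / 6) := by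
  have h := (exp_bigO (-1) 4).mul (isBigO_refl (fun t : ℝ => t⁻¹) (𝓝[>] 0))
  refine (h.neg_left).congr' ?_ ?_
  · filter_upwards [self_mem_nhdsWithin] with t ht
    have : t ≠ 0 := ne_of_gt ht
    simp [Finset.sum_range_succ, Nat.factorial]; field_simp; ring
  · filter_upwards [self_mem_nhdsWithin] with t ht
    have : t ≠ 0 := ne_of_gt ht
    field_simp

lemma one_sub_exp_pos {t : ℝ} (ht : 0 < t) : 0 < 1 - exp (-t) := by
  have : exp (-t) < 1 := by simpa using ht
  linarith

lemma bJet_phi : bJet (fun t => t / (1 - exp (-t))) 1 (1 / 2) (1 / 12) := by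
  have hp : bJet (fun t => 1 + 1 / 2 * t + 1 / 12 * t ^ 2) 1 (1 / 2) (1 / 12) := by
    unfold bJet; simp only [sub_self]; exact isBigO_zero _ _
  have h := hp.mul bJet_psi
  have hl : Tendsto (fun t : ℝ => (1 - exp (-t)) / t) (𝓝[>] 0) (𝓝 1) := by
    have h0 : (fun t : ℝ => (1 - exp (-t)) / t - (1 + -1 / 2 * t + 1 / 6 * t ^ 2)) =O[𝓝[>] 0]
      (fun t : ℝ => t ^ 3) := bJet_psi
    have h3 : Tendsto (fun t : ℝ => t ^ 3) (𝓝[>] 0) (𝓝 0) := by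
      have : Tendsto (fun t : ℝ => t ^ 3) (𝓝 0) (𝓝 (0 ^ 3)) := (continuous_pow 3).tendsto 0
      simpa using this.mono_left nhdsWithin_le_nhds
    have h1 := h0.trans_tendsto h3
    have h2 : Tendsto (fun t : ℝ => 1 + -1 / 2 * t + 1 / 6 * t ^ 2) (𝓝[>] 0) (𝓝 1) := by
      have : Continuous (fun t : ℝ => 1 + -1 / 2 * t + 1 / 6 * t ^ 2) := by fun_prop
      have := this.tendsto 0
      simp only [mul_zero, add_zero, ne_eq, OfNat.ofNat_ne_zero, not_false_eq_true, zero_pow] at this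
      exact this.mono_left nhdsWithin_le_nhds
    simpa using h1.add h2
  have hi := (hl.inv₀ one_ne_zero).isBigO_one ℝ
  have := (IsBigO.mul h hi).neg_left
  refine this.congr' ?_ ?_
  · filter_upwards [self_mem_nhdsWithin] with t ht
    have h1 : t ≠ 0 := ne_of_gt ht
    have h2 := (one_sub_exp_pos ht).ne'
    field_simp; ring
  · filter_upwards with t
    simp

noncomputable def bF (w z t : ℝ) : ℝ := exp (-z * t) / ((1 - exp (-t)) * (1 - exp (-(w * t))))

lemma bF_jet {w : ℝ} (hw : 0 < w) (z : ℝ) :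
    bJet (fun t => exp t * (t ^ 2 * bF w z t)) (1 / w) ((1 - z) / w + (1 + w) / (2 * w))
      (((1 - z) ^ 2 / 2 + (1 - z) * (1 + w) / 2 + (1 / 12 + w / 4 + w ^ 2 / 12)) / w) := by
  have h := ((bJet_exp (1 - z)).mul bJet_phi).mul (bJet_phi.scale hw)
  have h' := IsBigO.const_mul_left h (1 / w)
  refine h'.congr_left fun t => ?_
  have he : exp ((1 - z) * t) = exp t * exp (-z * t) := by rw [← exp_add]; ring_nf
  simp only [he, bF]
  have hw' := hw.ne'
  have e1 : 1 / w * (exp t * exp (-z * t) * (t / (1 - exp (-t))) * (w * t / (1 - exp (-(w * t)))))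
    = exp t * (t ^ 2 * (exp (-z * t) / ((1 - exp (-t)) * (1 - exp (-(w * t)))))) := by
    simp only [div_eq_mul_inv, mul_inv]
    linear_combination (exp t * exp (-z * t) * t * (1 - exp (-t))⁻¹ * t * (1 - exp (-(w * t)))⁻¹) * (mul_inv_cancel₀ hw')
  rw [mul_sub, e1]
  congr 1
  field_simp
  ring

noncomputable def bG (w z a b c t : ℝ) : ℝ := bF w z t - (a * t⁻¹ ^ 2 + b * t⁻¹ + c) * exp (-t)

lemma bG_zero {w z a b c : ℝ} (h : bJet (fun t => exp t * (t ^ 2 * bF w z t)) a b c) :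
    bG w z a b c =O[𝓝[>] 0] (fun t : ℝ => t ^ (-(-1 : ℝ))) := by
  have h1 := IsBigO.mul (IsBigO.mul (cont_bigO_one (f := fun t => exp (-t)) (by fun_prop)) h)
    (isBigO_refl (fun t : ℝ => t⁻¹ ^ 2) (𝓝[>] 0))
  refine h1.congr' ?_ ?_
  · filter_upwards [self_mem_nhdsWithin] with t ht
    have h1 : t ≠ 0 := ne_of_gt ht
    have h2 : exp (-t) * exp t = 1 := by rw [← exp_add]; simp
    have h3 : t * t⁻¹ = 1 := mul_inv_cancel₀ h1
    unfold bG
    field_simp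
    linear_combination (t ^ 2 * bF w z t) * h2
  · filter_upwards [self_mem_nhdsWithin] with t ht
    have h1 : t ≠ 0 := ne_of_gt ht
    simp only [neg_neg, rpow_one]
    field_simp

lemma bF_top {w z : ℝ} (hw : 0 < w) :
    bF w z =O[atTop] (fun t : ℝ => exp (-z * t)) := by
  have hl : Tendsto (fun t : ℝ => ((1 - exp (-t)) * (1 - exp (-(w * t))))⁻¹) atTop (𝓝 1) := by
    have h1 : Tendsto (fun t : ℝ => exp (-t)) atTop (𝓝 0) := tendsto_exp_neg_atTop_nhds_zero
    have h2 : Tendsto (fun t : ℝ => exp (-(w * t))) atTop (𝓝 0) :=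
      h1.comp (tendsto_id.const_mul_atTop hw)
    have := (((tendsto_const_nhds (x := (1:ℝ))).sub h1).mul ((tendsto_const_nhds (x := (1:ℝ))).sub h2))
    simpa using this.inv₀ (by norm_num)
  have := (isBigO_refl (fun t : ℝ => exp (-z * t)) atTop).mul (hl.isBigO_one ℝ)
  simp only [mul_one] at this
  exact this

lemma exp_mono_top {d z : ℝ} (h : d ≤ z) :
    (fun t : ℝ => exp (-z * t)) =O[atTop] (fun t : ℝ => exp (-d * t)) := by
  refine IsBigO.of_bound 1 ?_
  filter_upwards [eventually_ge_atTop 0] with t ht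
  rw [one_mul, norm_of_nonneg (exp_pos _).le, norm_of_nonneg (exp_pos _).le]
  exact exp_le_exp.2 (by nlinarith)

lemma bG_top {w z : ℝ} (hw : 0 < w) (a b c : ℝ) :
    bG w z a b c =O[atTop] (fun t : ℝ => exp (-(min z 1) * t)) := by
  refine ((bF_top hw).trans (exp_mono_top (min_le_left _ _))).sub ?_
  have hl : Tendsto (fun t : ℝ => a * t⁻¹ ^ 2 + b * t⁻¹ + c) atTop (𝓝 (a * 0 ^ 2 + b * 0 + c)) :=
    (((tendsto_inv_atTop_zero.pow 2).const_mul a).add (tendsto_inv_atTop_zero.const_mul b)).add_const c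
  have := (hl.isBigO_one ℝ).mul (exp_mono_top (min_le_right z 1))
  simpa using this

lemma bF_cont {w : ℝ} (hw : 0 < w) (z : ℝ) : ContinuousOn (bF w z) (Ioi 0) := by
  unfold bF
  refine ContinuousOn.div (by fun_prop) (by fun_prop) fun t ht => ?_
  exact mul_ne_zero (one_sub_exp_pos ht).ne' (one_sub_exp_pos (mul_pos hw ht)).ne'

lemma bG_cont {w : ℝ} (hw : 0 < w) (z a b c : ℝ) : ContinuousOn (bG w z a b c) (Ioi 0) := by
  unfold bG
  have : ContinuousOn (fun t : ℝ => t⁻¹) (Ioi 0) := continuousOn_inv₀.mono fun t ht => ne_of_gt ht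
  exact (bF_cont hw z).sub (by fun_prop)

lemma bF_hasSum {w z : ℝ} (hw : 0 < w) {t : ℝ} (ht : 0 < t) :
    HasSum (fun i : ℕ × ℕ => exp (-(z + i.1 * w + i.2) * t)) (bF w z t) := by
  have h1 : HasSum (fun p : ℕ => exp (-(w * t)) ^ p) (1 - exp (-(w * t)))⁻¹ :=
    hasSum_geometric_of_lt_one (exp_pos _).le (by simpa using mul_pos hw ht)
  have h2 : HasSum (fun p : ℕ => exp (-t) ^ p) (1 - exp (-t))⁻¹ :=
    hasSum_geometric_of_lt_one (exp_pos _).le (by simpa using ht)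
  have h3 := h1.mul h2 (h1.summable.mul_of_nonneg h2.summable
    (fun _ => by positivity) (fun _ => by positivity))
  have h4 := h3.mul_left (exp (-z * t))
  convert! h4 using 1
  · ext i
    rw [← exp_nat_mul, ← exp_nat_mul, ← exp_add, ← exp_add]
    ring_nf
  · unfold bF
    rw [mul_comm (1 - exp (-t)), div_eq_mul_inv, mul_inv]

lemma b_summable {w z : ℝ} (hw : 0 < w) (hz : 0 < z) {σ : ℝ} (hσ : 2 < σ) :
    Summable (fun i : ℕ × ℕ => 1 / (z + i.1 * w + i.2) ^ σ) := by
  obtain ⟨d, hd, hdz, hdw, hd1⟩ : ∃ d : ℝ, 0 < d ∧ d ≤ z ∧ d ≤ w ∧ d ≤ 1 :=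
    ⟨min z (min w 1), by positivity, min_le_left _ _, (min_le_right _ _).trans (min_le_left _ _),
      (min_le_right _ _).trans (min_le_right _ _)⟩
  have h1 : Summable (fun n : ℕ => 1 / ((n : ℝ) + 1) ^ (σ / 2)) := by
    have := (summable_nat_add_iff 1).2 (Real.summable_one_div_nat_rpow.2 (by linarith : 1 < σ / 2))
    simpa using this
  have h2 := (h1.mul_of_nonneg h1 (fun _ => by positivity) (fun _ => by positivity)).mul_left
    (1 / d ^ σ)
  refine Summable.of_nonneg_of_le (fun i => by positivity) (fun i => ?_) h2
  obtain ⟨p, q⟩ := i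
  simp only
  have hp : (0 : ℝ) ≤ p := p.cast_nonneg
  have hq : (0 : ℝ) ≤ q := q.cast_nonneg
  have e : d ^ σ * (((p : ℝ) + 1) ^ (σ / 2) * ((q : ℝ) + 1) ^ (σ / 2)) ≤ (z + p * w + q) ^ σ := by
    have hb : 0 ≤ d * (p + q + 1) := by positivity
    have k1 : d * (p + q + 1) ≤ z + p * w + q := by nlinarith
    have k2 : ((p : ℝ) + 1) * (q + 1) ≤ (p + q + 1) ^ 2 := by nlinarith
    calc _ = d ^ σ * (((p : ℝ) + 1) * (q + 1)) ^ (σ / 2) := by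
          rw [Real.mul_rpow (by positivity) (by positivity)]
      _ ≤ d ^ σ * (((p : ℝ) + q + 1) ^ 2) ^ (σ / 2) := by
          gcongr
      _ = (d * (p + q + 1)) ^ σ := by
          rw [Real.mul_rpow (by positivity) (by positivity), ← Real.rpow_natCast, ← Real.rpow_mul (by positivity)]
          congr 2; push_cast; ring
      _ ≤ _ := by gcongr
  calc _ ≤ 1 / (d ^ σ * (((p : ℝ) + 1) ^ (σ / 2) * ((q : ℝ) + 1) ^ (σ / 2))) :=
        one_div_le_one_div_of_le (by positivity) e
    _ = _ := by simp only [one_div, mul_inv]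

lemma b_mellinF {w z : ℝ} (hw : 0 < w) (hz : 0 < z) {s : ℂ} (hs : 2 < s.re) :
    mellin (fun t => (bF w z t : ℂ)) s
      = Complex.Gamma s * ∑' (p : ℕ) (q : ℕ), ((z : ℂ) + p * w + q) ^ (-s) := by
  have hpos : ∀ i : ℕ × ℕ, 0 < z + i.1 * w + i.2 := fun i => by positivity
  have h := hasSum_mellin (ι := ℕ × ℕ) (a := fun _ => 1) (p := fun i => z + i.1 * w + i.2)
    (F := fun t => (bF w z t : ℂ)) (s := s) (fun i => Or.inr (hpos i)) (by linarith)
    (fun t ht => by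
      have := Complex.hasSum_ofReal.2 (bF_hasSum (z := z) hw ht)
      simpa using this)
    (by simpa using b_summable hw hz hs)
  have hG : Complex.Gamma s ≠ 0 := Complex.Gamma_ne_zero_of_re_pos (by linarith)
  have h' := h.mul_left (Complex.Gamma s)⁻¹
  have e : (fun i : ℕ × ℕ => (Complex.Gamma s)⁻¹ * (Complex.Gamma s * 1 /
      ((z + i.1 * w + i.2 : ℝ) : ℂ) ^ s)) = fun i : ℕ × ℕ => ((z : ℂ) + i.1 * w + i.2) ^ (-s) := by
    ext i
    rw [Complex.cpow_neg]
    push_cast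
    field_simp
  rw [e] at h'
  rw [← h'.summable.tsum_prod, h'.tsum_eq, mul_inv_cancel_left₀ hG]

lemma b_gammaconv {s : ℂ} (hs : 0 < s.re) :
    HasMellin (fun t : ℝ => ((exp (-t) : ℝ) : ℂ)) s (Complex.Gamma s) := by
  refine ⟨?_, ?_⟩
  · have := Complex.GammaIntegral_convergent hs
    unfold MellinConvergent
    simpa [mul_comm] using this
  · rw [Complex.Gamma_eq_integral hs, Complex.GammaIntegral_eq_mellin]

lemma b_gammaconv' {s : ℂ} (n : ℕ) (hs : n < s.re) :
    HasMellin (fun t : ℝ => ((t : ℂ) ^ (-(n : ℂ))) • ((exp (-t) : ℝ) : ℂ)) s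
      (Complex.Gamma (s - n)) := by
  have h := b_gammaconv (s := s + -(n : ℂ)) (by simpa using hs)
  refine ⟨MellinConvergent.cpow_smul.2 h.1, ?_⟩
  rw [mellin_cpow_smul, h.2, sub_eq_add_neg]

lemma bG_loc {w : ℝ} (hw : 0 < w) (z a b c : ℝ) :
    MeasureTheory.LocallyIntegrableOn (fun t => (bG w z a b c t : ℂ)) (Ioi 0) :=
  (Complex.continuous_ofReal.comp_continuousOn (bG_cont hw z a b c)).locallyIntegrableOn
    measurableSet_Ioi

lemma b_mellin_eq {w z a b c : ℝ} (hw : 0 < w) (hz : 0 < z)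
    (h : bJet (fun t => exp t * (t ^ 2 * bF w z t)) a b c) {s : ℂ} (hs : 2 < s.re) :
    mellin (fun t => (bF w z t : ℂ)) s = mellin (fun t => (bG w z a b c t : ℂ)) s
      + (a * Complex.Gamma (s - 2) + b * Complex.Gamma (s - 1) + c * Complex.Gamma s) := by
  have hc : MellinConvergent (fun t => (bG w z a b c t : ℂ)) s :=
    mellinConvergent_of_isBigO_rpow_exp (a := min z 1) (b := -1) (by positivity) (bG_loc hw z a b c)
      (Complex.isBigO_ofReal_left.2 (bG_top hw a b c)) (Complex.isBigO_ofReal_left.2 (bG_zero h))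
      (by linarith)
  have k2 := b_gammaconv' (s := s) 2 (by simpa using hs)
  have k1 := b_gammaconv' (s := s) 1 (by push_cast; linarith)
  have k0 := b_gammaconv (s := s) (by linarith)
  have m2 := hasMellin_const_smul k2.1 (a : ℂ)
  have m1 := hasMellin_const_smul k1.1 (b : ℂ)
  have m0 := hasMellin_const_smul k0.1 (c : ℂ)
  have m21 := hasMellin_add m2.1 m1.1
  have m210 := hasMellin_add m21.1 m0.1
  have m := hasMellin_add hc m210.1
  have e := m.2
  rw [m210.2, m21.2, m2.2, m1.2, m0.2, k2.2, k1.2, k0.2] at e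
  simp only [smul_eq_mul, Nat.cast_ofNat, Nat.cast_one] at e
  rw [← e]
  refine MeasureTheory.setIntegral_congr_fun measurableSet_Ioi fun t ht => ?_
  have ht' : (t : ℂ) ≠ 0 := by exact_mod_cast (ne_of_gt ht)
  simp only [Complex.cpow_neg, Complex.cpow_one, Complex.cpow_ofNat, bG]
  push_cast
  congr 1
  field_simp
  ring

theorem barnesZeta2_zero (ω x y : ℝ) (hω : 0 < ω) (hx : 0 < x) (hy : 0 ≤ y)
    (H : ℂ → ℂ) (hH : IsBarnesZeta2 ω (x * ω + y) H) :
    H 0 = ((ω / 2 * (x ^ 2 - x + 1 / 6) + (x - 1 / 2) * (y - 1 / 2)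
      + 1 / (2 * ω) * (y ^ 2 - y + 1 / 6) : ℝ) : ℂ) := by
  obtain ⟨hd, hs⟩ := hH
  have hz : 0 < x * ω + y := by positivity
  generalize hzz : x * ω + y = z at *
  have hj := bF_jet hω z
  generalize ha : (1 / ω) = a at hj
  generalize hb : ((1 - z) / ω + (1 + ω) / (2 * ω)) = b at hj
  generalize hc : (((1 - z) ^ 2 / 2 + (1 - z) * (1 + ω) / 2 + (1 / 12 + ω / 4 + ω ^ 2 / 12)) / ω) = c at hj
  let K : ℂ → ℂ := fun s => a / ((s - 1) * (s - 2)) + b / (s - 1) + c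
    + (Complex.Gamma s)⁻¹ * mellin (fun t => (bG ω z a b c t : ℂ)) s
  have hK : ∀ s : ℂ, -1 < s.re → s ≠ 1 → s ≠ 2 → DifferentiableAt ℂ K s := by
    intro s h0 h1 h2
    have hm : DifferentiableAt ℂ (mellin (fun t => (bG ω z a b c t : ℂ))) s :=
      mellin_differentiableAt_of_isBigO_rpow_exp (a := min z 1) (b := -1) (by positivity)
        (bG_loc hω z a b c) (Complex.isBigO_ofReal_left.2 (bG_top hω a b c))
        (Complex.isBigO_ofReal_left.2 (bG_zero hj)) h0
    have hg : DifferentiableAt ℂ (fun s => (Complex.Gamma s)⁻¹) s :=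
      Complex.differentiable_one_div_Gamma s
    have h1' := sub_ne_zero.2 h1
    have h2' := sub_ne_zero.2 h2
    refine DifferentiableAt.add (DifferentiableAt.add (DifferentiableAt.add ?_ ?_) ?_) (hg.mul hm)
    · exact (differentiableAt_const _).div (by fun_prop) (mul_ne_zero h1' h2')
    · exact (differentiableAt_const _).div (by fun_prop) h1'
    · exact differentiableAt_const _
  have hHK : ∀ s : ℂ, 2 < s.re → H s = K s := by
    intro s h2
    have hG : Complex.Gamma s ≠ 0 := Complex.Gamma_ne_zero_of_re_pos (by linarith)
    have n1 : s - 1 ≠ 0 := by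
      intro h; have := congrArg Complex.re h; simp at this; linarith
    have n2 : s - 2 ≠ 0 := by
      intro h; have := congrArg Complex.re h; simp at this; linarith
    have e := b_mellinF hω hz h2
    rw [← hs s h2, b_mellin_eq hω hz hj h2] at e
    have g1 : Complex.Gamma s = (s - 1) * Complex.Gamma (s - 1) := by
      rw [← Complex.Gamma_add_one _ n1]; ring_nf
    have g2 : Complex.Gamma (s - 1) = (s - 2) * Complex.Gamma (s - 2) := by
      rw [← Complex.Gamma_add_one _ n2]; ring_nf
    have e1 : Complex.Gamma (s - 1) = Complex.Gamma s / (s - 1) := by rw [g1]; field_simp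
    have e2 : Complex.Gamma (s - 2) = Complex.Gamma s / ((s - 1) * (s - 2)) := by
      rw [g1, g2]; field_simp
    rw [e1, e2] at e
    apply mul_left_cancel₀ hG
    rw [← e]
    simp only [K]
    field_simp
    ring
  let U : Set ℂ := {s | -1 < s.re} ∩ {s | 0 < s.im}
  have hUo : IsOpen U := (isOpen_lt continuous_const Complex.continuous_re).inter
    (isOpen_lt continuous_const Complex.continuous_im)
  have hUc : Convex ℝ U := (convex_halfSpace_re_gt _).inter (convex_halfSpace_im_gt _)
  have hUn : ∀ s ∈ U, s ≠ 1 ∧ s ≠ 2 := by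
    rintro s ⟨_, h⟩
    refine ⟨?_, ?_⟩ <;> rintro rfl <;> simp at h
  have hcompl : IsOpen (({1, 2} : Set ℂ)ᶜ) := (Set.toFinite _).isClosed.isOpen_compl
  have hHd : ∀ s : ℂ, s ≠ 1 → s ≠ 2 → DifferentiableAt ℂ H s := fun s h1 h2 =>
    hd.differentiableAt (hcompl.mem_nhds (by simp [h1, h2]))
  have hA : AnalyticOnNhd ℂ H U := DifferentiableOn.analyticOnNhd
    (fun s h => (hHd s (hUn s h).1 (hUn s h).2).differentiableWithinAt) hUo
  have hB : AnalyticOnNhd ℂ K U := DifferentiableOn.analyticOnNhd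
    (fun s h => (hK s h.1 (hUn s h).1 (hUn s h).2).differentiableWithinAt) hUo
  have h0 : (3 + Complex.I) ∈ U := by constructor <;> simp <;> norm_num
  have hev : H =ᶠ[𝓝 (3 + Complex.I)] K := by
    filter_upwards [(isOpen_lt continuous_const Complex.continuous_re).mem_nhds
      (show (2 : ℝ) < (3 + Complex.I).re by simp; norm_num)] with s h using hHK s h
  have hEq : EqOn H K U := hA.eqOn_of_preconnected_of_eventuallyEq hB hUc.isPreconnected h0 hev
  have hlim : Tendsto (fun e : ℝ => (e : ℂ) * Complex.I) (𝓝[>] 0) (𝓝 0) := by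
    have : Continuous (fun e : ℝ => (e : ℂ) * Complex.I) := by fun_prop
    have := this.tendsto 0
    simp only [Complex.ofReal_zero, zero_mul] at this
    exact this.mono_left nhdsWithin_le_nhds
  have l1 := (hHd 0 (by norm_num) (by norm_num)).continuousAt.tendsto.comp hlim
  have l2 := (hK 0 (by norm_num) (by norm_num) (by norm_num)).continuousAt.tendsto.comp hlim
  have h00 : H 0 = K 0 := by
    refine tendsto_nhds_unique (l1.congr' ?_) l2
    filter_upwards [self_mem_nhdsWithin] with e he
    exact hEq ⟨by simp, by simpa using he⟩
  rw [h00]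
  have : K 0 = ((a / 2 - b + c : ℝ) : ℂ) := by
    simp only [K, Complex.Gamma_zero]
    push_cast
    simp
    ring
  rw [this, ← ha, ← hb, ← hc, ← hzz]
  congr 1
  field_simp
  ring
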